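/- arXiv:1502.06072 — 9 statements merged into one kernel-verified Lean document; each statement's English description precedes it below -/
import Mathlib

section
/- Let ρ̄ > 0 and define S : ℝ → ℝ by S(t) = sin(πρ̄ t)/(π t) for t ≠ 0 and S(0) = ρ̄. Then for every n ∈ ℕ, all points x₁, …, xₙ ∈ ℝ and all complex numbers c₁, …, cₙ, the double sum ∑_{i=1}^{n} ∑_{j=1}^{n} c_i · conj(c_j) · S(x_i − x_j) is a real number and is nonnegative. -/
open Finset

/-- The Fourier transform of the indicator function of `[-a, a]`. -/
lemma integral_cexp_symm_interval (a : ℝ) {t : ℝ} (ht : t ≠ 0) :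
    ∫ u in (-a)..a, Complex.exp (t * Complex.I * u) = ((2 * Real.sin (a * t) / t : ℝ) : ℂ) := by
  have htc : (t : ℂ) ≠ 0 := by exact_mod_cast ht
  rw [integral_exp_mul_complex (mul_ne_zero htc Complex.I_ne_zero)]
  push_cast
  rw [Complex.sin, show (t : ℂ) * Complex.I * a = a * t * Complex.I by ring,
    show (t : ℂ) * Complex.I * -a = -(a * t) * Complex.I by ring]
  field_simp
  rw [Complex.I_sq]
  ring

/-- A quadratic form in the characters `u ↦ exp (i x u)` is a squared modulus. -/
lemma sum_mul_conj_mul_cexp_eq_normSq {ι : Type*} [Fintype ι] (x : ι → ℝ) (c : ι → ℂ) (u : ℝ) :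
    ∑ i, ∑ j, c i * (starRingEnd ℂ) (c j) *
        Complex.exp (((x i - x j : ℝ) : ℂ) * Complex.I * u) =
      (Complex.normSq (∑ i, c i * Complex.exp (x i * Complex.I * u)) : ℂ) := by
  rw [← Complex.mul_conj, map_sum, Finset.sum_mul_sum]
  refine Finset.sum_congr rfl fun i _ => Finset.sum_congr rfl fun j _ => ?_
  rw [map_mul, ← Complex.exp_conj, mul_mul_mul_comm, ← Complex.exp_add]
  simp only [map_mul, Complex.conj_ofReal, Complex.conj_I]
  push_cast
  ring_nf

/-- The sine kernel `S(t) = sin(πρ̄ t)/(π t)`, `S(0) = ρ̄`, is of positive type: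
every finite quadratic form `∑_{i,j} c_i conj(c_j) S(x_i - x_j)` is real and
nonnegative. -/
theorem sine_kernel_positive_type (ρ : ℝ) (hρ : 0 < ρ) (S : ℝ → ℝ)
    (hS : ∀ t : ℝ, t ≠ 0 → S t = Real.sin (Real.pi * ρ * t) / (Real.pi * t))
    (hS0 : S 0 = ρ) (n : ℕ) (x : Fin n → ℝ) (c : Fin n → ℂ) :
    (∑ i, ∑ j, c i * (starRingEnd ℂ) (c j) * ((S (x i - x j) : ℝ) : ℂ)).im = 0 ∧
      0 ≤ (∑ i, ∑ j, c i * (starRingEnd ℂ) (c j) * ((S (x i - x j) : ℝ) : ℂ)).re := by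
  have hpi : (Real.pi : ℂ) ≠ 0 := by exact_mod_cast Real.pi_ne_zero
  set a : ℝ := Real.pi * ρ with ha
  have hSint (t : ℝ) : (S t : ℂ) =
      (2 * Real.pi : ℂ)⁻¹ * ∫ u in (-a)..a, Complex.exp (t * Complex.I * u) := by
    rcases eq_or_ne t 0 with rfl | ht
    · simp only [hS0, Complex.ofReal_zero, zero_mul, Complex.exp_zero,
        intervalIntegral.integral_const, ha, Complex.real_smul]
      push_cast
      field_simp
      ring
    · have htc : (t : ℂ) ≠ 0 := by exact_mod_cast ht
      rw [integral_cexp_symm_interval a ht, hS t ht]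
      push_cast
      field_simp
  have hsum : ∑ i, ∑ j, c i * (starRingEnd ℂ) (c j) * ((S (x i - x j) : ℝ) : ℂ) =
      (((2 * Real.pi)⁻¹ * ∫ u in (-a)..a,
        Complex.normSq (∑ i, c i * Complex.exp (x i * Complex.I * u)) : ℝ) : ℂ) := by
    rw [Complex.ofReal_mul, ← intervalIntegral.integral_ofReal]
    simp_rw [← sum_mul_conj_mul_cexp_eq_normSq]
    rw [intervalIntegral.integral_finsetSum
      fun i _ => Continuous.intervalIntegrable (by fun_prop) _ _, Finset.mul_sum]
    refine Finset.sum_congr rfl fun i _ => ?_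
    rw [intervalIntegral.integral_finsetSum
      fun j _ => Continuous.intervalIntegrable (by fun_prop) _ _, Finset.mul_sum]
    refine Finset.sum_congr rfl fun j _ => ?_
    rw [intervalIntegral.integral_const_mul, hSint]
    push_cast
    ring
  rw [hsum, Complex.ofReal_im, Complex.ofReal_re]
  have ha0 : 0 < a := mul_pos Real.pi_pos hρ
  exact ⟨rfl, mul_nonneg (by positivity) (intervalIntegral.integral_nonneg (by linarith)
    fun u _ => Complex.normSq_nonneg _)⟩
end

section
/- Let n ≥ 2, r > 0, M > 0, L > 0, and let K : ℝ × ℝ → ℝ satisfy |K(x,y)| ≤ M for all x, y ∈ [−r, r] and |K(x,y) − K(x',y)| ≤ L|x − x'| for all x, x', y ∈ [−r, r]. Then for all x₁, …, xₙ ∈ [−r, r], |det(K(x_i, x_j))_{1≤i,j≤n}| ≤ n^{n/2} · L · M^{n−1} · min_{i ≠ j} |x_i − x_j|. -/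
/-- **Hadamard's inequality**: the determinant of a real matrix is bounded by the product of the
Euclidean norms of its rows. -/
theorem Matrix.abs_det_le_prod_norm_row {n : ℕ} (A : Matrix (Fin n) (Fin n) ℝ) :
    |A.det| ≤ ∏ i, ‖WithLp.toLp 2 (A i)‖ := by
  let b := EuclideanSpace.basisFun (Fin n) ℝ
  have : Fact (Module.finrank ℝ (EuclideanSpace ℝ (Fin n)) = n) := ⟨by simp⟩
  have h := b.toBasis.orientation.abs_volumeForm_apply_le fun i => WithLp.toLp 2 (A i)
  rw [Orientation.volumeForm_robust' _ b, Module.Basis.det_apply] at h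
  have hA : b.toBasis.toMatrix (fun i => WithLp.toLp 2 (A i)) = A.transpose := by
    ext i j
    simp [b, Module.Basis.toMatrix_apply]
  rwa [hA, Matrix.det_transpose] at h

/-- Hadamard's inequality for a matrix whose `i`-th row has entries bounded by `c i`. -/
theorem Matrix.abs_det_le_rpow_mul_prod {n : ℕ} (A : Matrix (Fin n) (Fin n) ℝ) (c : Fin n → ℝ)
    (hc : ∀ i, 0 ≤ c i) (hA : ∀ i j, |A i j| ≤ c i) :
    |A.det| ≤ (n : ℝ) ^ ((n : ℝ) / 2) * ∏ i, c i := by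
  have hrow (i : Fin n) : ‖WithLp.toLp 2 (A i)‖ ≤ √n * c i := by
    rw [EuclideanSpace.norm_eq, ← Real.sqrt_sq (hc i), ← Real.sqrt_mul n.cast_nonneg]
    apply Real.sqrt_le_sqrt
    calc ∑ j, ‖A i j‖ ^ 2 ≤ ∑ _j : Fin n, c i ^ 2 :=
          Finset.sum_le_sum fun j _ => pow_le_pow_left₀ (norm_nonneg _) (hA i j) 2
      _ = n * c i ^ 2 := by simp
  calc |A.det| ≤ ∏ i, ‖WithLp.toLp 2 (A i)‖ := A.abs_det_le_prod_norm_row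
    _ ≤ ∏ i, √n * c i := Finset.prod_le_prod (fun i _ => norm_nonneg _) fun i _ => hrow i
    _ = (n : ℝ) ^ ((n : ℝ) / 2) * ∏ i, c i := by
      rw [Finset.prod_mul_distrib, Finset.prod_const, Finset.card_univ, Fintype.card_fin,
        Real.sqrt_eq_rpow, ← Real.rpow_mul_natCast n.cast_nonneg, one_div_mul_eq_div]

/-- If `K` is bounded by `M` and Lipschitz (with constant `L`) in its first
variable on `[-r, r]`, then for points `x₁, …, xₙ ∈ [-r, r]` the determinant
`det (K(x_i, x_j))` is bounded by `n^(n/2) · L · M^(n-1) · min_{i ≠ j} |x_i - x_j|`. -/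
theorem abs_det_kernel_le_min_gap (n : ℕ) (hn : 2 ≤ n) (r M L : ℝ)
    (hr : 0 < r) (hM : 0 < M) (hL : 0 < L) (K : ℝ → ℝ → ℝ)
    (hKbdd : ∀ x ∈ Set.Icc (-r) r, ∀ y ∈ Set.Icc (-r) r, |K x y| ≤ M)
    (hKlip : ∀ x ∈ Set.Icc (-r) r, ∀ x' ∈ Set.Icc (-r) r, ∀ y ∈ Set.Icc (-r) r,
      |K x y - K x' y| ≤ L * |x - x'|)
    (x : Fin n → ℝ) (hx : ∀ i, x i ∈ Set.Icc (-r) r) :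
    |(Matrix.of fun i j => K (x i) (x j)).det| ≤
      (n : ℝ) ^ ((n : ℝ) / 2) * L * M ^ (n - 1) *
        sInf {d : ℝ | ∃ i j : Fin n, i ≠ j ∧ d = |x i - x j|} := by
  set S := {d : ℝ | ∃ i j : Fin n, i ≠ j ∧ d = |x i - x j|}
  have hfin : S.Finite := by
    refine (Set.finite_range fun p : Fin n × Fin n => |x p.1 - x p.2|).subset ?_
    rintro d ⟨i, j, -, rfl⟩
    exact ⟨(i, j), rfl⟩
  have hne : S.Nonempty := ⟨_, ⟨0, by lia⟩, ⟨1, by lia⟩, by simp, rfl⟩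
  obtain ⟨i, j, hij, hd⟩ := hne.csInf_mem hfin
  rw [hd]
  set A : Matrix (Fin n) (Fin n) ℝ := Matrix.of fun i j => K (x i) (x j) with hA
  have hdet : (A.updateRow i (A i + (-1 : ℝ) • A j)).det = A.det :=
    A.det_updateRow_add_smul_self hij (-1)
  rw [← hdet]
  refine (Matrix.abs_det_le_rpow_mul_prod _
    (Function.update (fun _ => M) i (L * |x i - x j|)) (fun k => ?_) fun k l => ?_).trans_eq ?_
  · by_cases hk : k = i
    · subst hk
      simp only [Function.update_self]
      positivity
    · simpa [hk] using hM.le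
  · by_cases hk : k = i
    · subst hk
      simpa [hA, ← sub_eq_add_neg] using hKlip _ (hx k) _ (hx j) _ (hx l)
    · simpa [hA, hk] using hKbdd _ (hx k) _ (hx l)
  · rw [Finset.prod_update_of_mem (Finset.mem_univ i), Finset.prod_const,
      ← Finset.compl_eq_univ_sdiff, Finset.card_compl, Finset.card_singleton, Fintype.card_fin]
    ring
end

section
/- Let n ∈ ℕ, r > 0, M > 0, and for each k ≥ 0 let ρ_{n+k} : ℝ^{n+k} → ℝ be a continuous function satisfying |ρ_{n+k}(y)| ≤ (n + k)^{(n+k)/2} · M^{n+k} for all y ∈ [−r, r]^{n+k}. Then for every x ∈ [−r, r]^n the series σ(x) = ∑_{k=0}^{∞} ((−1)^k / k!) ∫_{[−r,r]^k} ρ_{n+k}(x₁,…,xₙ, y₁,…,y_k) dy₁⋯dy_k converges absolutely, and the function σ so defined is continuous on [−r, r]^n. -/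
open MeasureTheory

/-- A nonnegative sequence `u` is summable as soon as `4 ^ k * u k ^ 2` is summable. -/
theorem summable_of_summable_four_pow_mul_sq {u : ℕ → ℝ} (hu : ∀ k, 0 ≤ u k)
    (h : Summable fun k => (4 : ℝ) ^ k * u k ^ 2) : Summable u := by
  have hgeom : Summable fun k : ℕ => ((1 : ℝ) / 4) ^ k :=
    summable_geometric_of_lt_one (by norm_num) (by norm_num)
  refine Summable.of_nonneg_of_le hu (fun k => ?_) (hgeom.add h)
  have h4 : (4 : ℝ) ^ k = (2 ^ k) ^ 2 := by rw [← pow_mul, mul_comm, pow_mul]; norm_num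
  have h14 : ((1 : ℝ) / 4) ^ k = ((1 / 2) ^ k) ^ 2 := by
    rw [← pow_mul, mul_comm, pow_mul]; norm_num
  have h1 : ((1 : ℝ) / 2) ^ k * 2 ^ k = 1 := by rw [← mul_pow]; norm_num
  have h2 : u k = (1 / 2) ^ k * (2 ^ k * u k) := by rw [← mul_assoc, h1, one_mul]
  rw [h4, h14, ← mul_pow]
  nlinarith [sq_nonneg (((1 : ℝ) / 2) ^ k - 2 ^ k * u k), hu k]

theorem pow_self_le_exp_mul_factorial (m : ℕ) :
    (m : ℝ) ^ m ≤ Real.exp 1 ^ m * (m.factorial : ℝ) := by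
  have h := Real.pow_div_factorial_le_exp (m : ℝ) m.cast_nonneg m
  rw [div_le_iff₀ (by positivity)] at h
  simpa [← Real.exp_nat_mul] using h

theorem factorial_add_le_two_pow_mul (n k : ℕ) :
    (n + k).factorial ≤ 2 ^ (n + k) * (n.factorial * k.factorial) := by
  rw [← Nat.add_choose_mul_factorial_mul_factorial, mul_assoc]
  exact Nat.mul_le_mul_right _ (Nat.choose_le_two_pow _ _)

theorem summable_hadamard_bound (n : ℕ) {M L : ℝ} (hM : 0 ≤ M) (hL : 0 ≤ L) :
    Summable fun k : ℕ =>
      1 / (k.factorial : ℝ) *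
        (((n + k : ℕ) : ℝ) ^ (((n : ℝ) + (k : ℝ)) / 2) * M ^ (n + k) * L ^ k) := by
  refine summable_of_summable_four_pow_mul_sq (fun k => by positivity) ?_
  have hs := (Real.summable_pow_div_factorial (4 * (2 * Real.exp 1 * M ^ 2) * L ^ 2)).mul_left
    ((n.factorial : ℝ) * (2 * Real.exp 1 * M ^ 2) ^ n)
  refine Summable.of_nonneg_of_le (fun k => by positivity) (fun k => ?_) hs
  have hsq : (((n + k : ℕ) : ℝ) ^ (((n : ℝ) + (k : ℝ)) / 2)) ^ 2
      = ((n + k : ℕ) : ℝ) ^ (n + k) := by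
    rw [← Real.rpow_natCast, ← Real.rpow_mul (by positivity), ← Real.rpow_natCast]
    congr 1
    push_cast
    ring
  have hpow : ((n + k : ℕ) : ℝ) ^ (n + k) ≤
      Real.exp 1 ^ (n + k) * (2 ^ (n + k) * (n.factorial * k.factorial)) :=
    (pow_self_le_exp_mul_factorial (n + k)).trans <| by
      gcongr
      exact_mod_cast factorial_add_le_two_pow_mul n k
  have hk : (k.factorial : ℝ) ≠ 0 := by positivity
  calc (4 : ℝ) ^ k * (1 / (k.factorial : ℝ) *
        (((n + k : ℕ) : ℝ) ^ (((n : ℝ) + (k : ℝ)) / 2) * M ^ (n + k) * L ^ k)) ^ 2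
      = 4 ^ k * (1 / (k.factorial : ℝ)) ^ 2 * (M ^ (n + k) * L ^ k) ^ 2 *
          ((n + k : ℕ) : ℝ) ^ (n + k) := by rw [← hsq]; ring
    _ ≤ 4 ^ k * (1 / (k.factorial : ℝ)) ^ 2 * (M ^ (n + k) * L ^ k) ^ 2 *
          (Real.exp 1 ^ (n + k) * (2 ^ (n + k) * (n.factorial * k.factorial))) := by gcongr
    _ = _ := by
      simp only [mul_pow, pow_add, ← pow_mul]
      field_simp
      ring

theorem append_mem_pi {n k : ℕ} {s : Set ℝ} {x : Fin n → ℝ} {y : Fin k → ℝ}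
    (hx : x ∈ Set.univ.pi fun _ => s) (hy : y ∈ Set.univ.pi fun _ => s) :
    Fin.append x y ∈ Set.univ.pi fun _ => s := by
  intro i _
  refine Fin.addCases (fun i => ?_) (fun i => ?_) i
  · simpa using hx i trivial
  · simpa using hy i trivial

theorem volume_real_pi_Icc (k : ℕ) {r : ℝ} (hr : 0 ≤ r) :
    volume.real (Set.univ.pi fun _ : Fin k => Set.Icc (-r) r) = (2 * r) ^ k := by
  rw [Measure.real, volume_pi_pi]
  simp only [Real.volume_Icc, Finset.prod_const, Finset.card_univ, Fintype.card_fin,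
    ENNReal.toReal_pow]
  rw [ENNReal.toReal_ofReal (by linarith)]
  ring

/-- The inclusion–exclusion series for the `n`-point density function: if the
correlation functions `ρ_{n+k}` are continuous and satisfy the Hadamard bound
`|ρ_{n+k}| ≤ (n+k)^((n+k)/2) M^(n+k)` on the box `[-r,r]^{n+k}`, then the
alternating series `σ(x) = ∑_k ((-1)^k/k!) ∫_{[-r,r]^k} ρ_{n+k}(x, y) dy`
converges absolutely on `[-r,r]^n` and defines a continuous function there. -/
theorem density_series_continuous (n : ℕ) (r M : ℝ) (hr : 0 < r) (hM : 0 < M)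
    (ρ : (k : ℕ) → (Fin (n + k) → ℝ) → ℝ)
    (hcont : ∀ k, Continuous (ρ k))
    (hbound : ∀ k, ∀ y ∈ Set.univ.pi fun _ : Fin (n + k) => Set.Icc (-r) r,
      |ρ k y| ≤ ((n + k : ℕ) : ℝ) ^ ((((n : ℝ) + (k : ℝ)) / 2 : ℝ)) * M ^ (n + k)) :
    (∀ x ∈ Set.univ.pi fun _ : Fin n => Set.Icc (-r) r,
      Summable (fun k : ℕ =>
        |((-1 : ℝ) ^ k / (Nat.factorial k : ℝ)) *
          ∫ y in Set.univ.pi fun _ : Fin k => Set.Icc (-r) r,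
            ρ k (Fin.append x y)|)) ∧
    ContinuousOn
      (fun x : Fin n → ℝ => ∑' k : ℕ,
        ((-1 : ℝ) ^ k / (Nat.factorial k : ℝ)) *
          ∫ y in Set.univ.pi fun _ : Fin k => Set.Icc (-r) r,
            ρ k (Fin.append x y))
      (Set.univ.pi fun _ : Fin n => Set.Icc (-r) r) := by
  have hcompact (k : ℕ) : IsCompact (Set.univ.pi fun _ : Fin k => Set.Icc (-r) r) :=
    isCompact_univ_pi fun _ => isCompact_Icc
  have hsum := summable_hadamard_bound n hM.le (show 0 ≤ 2 * r by linarith)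
  have hle (k : ℕ) (x : Fin n → ℝ) (hx : x ∈ Set.univ.pi fun _ : Fin n => Set.Icc (-r) r) :
      ‖((-1 : ℝ) ^ k / (Nat.factorial k : ℝ)) *
          ∫ y in Set.univ.pi fun _ : Fin k => Set.Icc (-r) r, ρ k (Fin.append x y)‖ ≤
        1 / (k.factorial : ℝ) *
          (((n + k : ℕ) : ℝ) ^ (((n : ℝ) + (k : ℝ)) / 2) * M ^ (n + k) * (2 * r) ^ k) := by
    have hcoef : ‖(-1 : ℝ) ^ k / (Nat.factorial k : ℝ)‖ = 1 / (k.factorial : ℝ) := by simp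
    rw [norm_mul, hcoef, ← volume_real_pi_Icc k hr.le]
    gcongr
    exact norm_setIntegral_le_of_norm_le_const (hcompact k).measure_lt_top
      fun y hy => hbound k _ (append_mem_pi hx hy)
  refine ⟨fun x hx => hsum.of_nonneg_of_le (fun _ => abs_nonneg _) fun k => hle k x hx,
    continuousOn_tsum (fun k => Continuous.continuousOn ?_) hsum hle⟩
  exact continuous_const.mul <| continuous_parametric_integral_of_continuous
    (f := fun x y => ρ k (Fin.append x y))
    ((hcont k).comp (Fin.continuous_append n k)) (hcompact k)
end

section
/- Let S be a compact metric space, let Λ ∈ [0, 1), let (λ_i)_{i∈ℕ} be real numbers with 0 ≤ λ_i ≤ Λ for all i, and let (φ_i)_{i∈ℕ} be continuous functions φ_i : S → ℂ. Suppose the series ∑_{i=0}^{∞} λ_i φ_i(x) conj(φ_i(y)) converges uniformly on S × S. Then the series L(x,y) = ∑_{i=0}^{∞} (λ_i/(1 − λ_i)) φ_i(x) conj(φ_i(y)) also converges uniformly on S × S, and the function L is continuous on S × S. -/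
open Filter Finset

/-- A weighted sum of `u i * conj (v i)` is controlled by the two diagonal sums, with the weights
`b` replaced by comparable weights `a`. -/
lemma norm_sum_mul_conj_le {ι : Type*} (s : Finset ι) (a b : ι → ℝ) (C : ℝ)
    (hC : 0 ≤ C) (hb : ∀ i, 0 ≤ b i) (hba : ∀ i, b i ≤ C * a i) (u v : ι → ℂ) :
    ‖∑ i ∈ s, (b i : ℂ) * u i * (starRingEnd ℂ) (v i)‖ ≤
      C / 2 * (‖∑ i ∈ s, (a i : ℂ) * u i * (starRingEnd ℂ) (u i)‖ +
        ‖∑ i ∈ s, (a i : ℂ) * v i * (starRingEnd ℂ) (v i)‖) := by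
  have diag (w : ι → ℂ) : ∑ i ∈ s, a i * ‖w i‖ ^ 2 ≤
      ‖∑ i ∈ s, (a i : ℂ) * w i * (starRingEnd ℂ) (w i)‖ := by
    have h : ∑ i ∈ s, (a i : ℂ) * w i * (starRingEnd ℂ) (w i) =
        ((∑ i ∈ s, a i * ‖w i‖ ^ 2 : ℝ) : ℂ) := by
      push_cast
      exact sum_congr rfl fun i _ => by rw [mul_assoc, Complex.mul_conj']
    rw [h, Complex.norm_real]
    exact le_abs_self _
  calc ‖∑ i ∈ s, (b i : ℂ) * u i * (starRingEnd ℂ) (v i)‖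
      ≤ ∑ i ∈ s, C / 2 * (a i * ‖u i‖ ^ 2 + a i * ‖v i‖ ^ 2) := by
        refine norm_sum_le_of_le s fun i _ => ?_
        rw [norm_mul, norm_mul, Complex.norm_real, Real.norm_of_nonneg (hb i), RCLike.norm_conj]
        nlinarith [mul_nonneg (hb i) (sq_nonneg (‖u i‖ - ‖v i‖)),
          mul_le_mul_of_nonneg_right (hba i) (add_nonneg (sq_nonneg ‖u i‖) (sq_nonneg ‖v i‖))]
    _ = C / 2 * (∑ i ∈ s, a i * ‖u i‖ ^ 2 + ∑ i ∈ s, a i * ‖v i‖ ^ 2) := by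
        rw [← mul_sum, sum_add_distrib]
    _ ≤ _ := by gcongr <;> exact diag _

/-- If `0 ≤ λ_i ≤ Λ < 1` and the series `∑ λ_i φ_i(x) conj(φ_i(y))` of continuous
functions converges uniformly on `S × S` (S compact metric), then the series
`L(x,y) = ∑ (λ_i/(1-λ_i)) φ_i(x) conj(φ_i(y))` also converges uniformly on
`S × S` and its sum is continuous. -/
theorem L_kernel_uniform_continuous (S : Type*) [MetricSpace S] [CompactSpace S]
    (Λ : ℝ) (hΛ0 : 0 ≤ Λ) (hΛ1 : Λ < 1)
    (lam : ℕ → ℝ) (hlam : ∀ i, 0 ≤ lam i ∧ lam i ≤ Λ)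
    (φ : ℕ → S → ℂ) (hφ : ∀ i, Continuous (φ i))
    (hunif : ∃ g : S × S → ℂ,
      TendstoUniformly
        (fun N (p : S × S) =>
          ∑ i ∈ Finset.range N, (lam i : ℂ) * φ i p.1 * (starRingEnd ℂ) (φ i p.2))
        g atTop) :
    ∃ L : S × S → ℂ,
      TendstoUniformly
        (fun N (p : S × S) =>
          ∑ i ∈ Finset.range N,
            ((lam i / (1 - lam i) : ℝ) : ℂ) * φ i p.1 * (starRingEnd ℂ) (φ i p.2))
        L atTop ∧ Continuous L := by
  obtain ⟨g, hg⟩ := hunif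
  set F : ℕ → S × S → ℂ := fun N p =>
    ∑ i ∈ Finset.range N,
      ((lam i / (1 - lam i) : ℝ) : ℂ) * φ i p.1 * (starRingEnd ℂ) (φ i p.2) with hF
  have hΛ : 0 < 1 - Λ := by linarith
  have hb (i : ℕ) : 0 ≤ lam i / (1 - lam i) :=
    div_nonneg (hlam i).1 (by linarith [(hlam i).2])
  have hba (i : ℕ) : lam i / (1 - lam i) ≤ (1 - Λ)⁻¹ * lam i := by
    rw [div_eq_inv_mul]
    have := hlam i
    gcongr
    · exact this.1
    · exact this.2
  have hK := hg.tendstoUniformlyOn (s := Set.univ) |>.uniformCauchySeqOn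
  have hcauchy : UniformCauchySeqOn F atTop Set.univ := by
    rw [Metric.uniformCauchySeqOn_iff] at hK ⊢
    intro ε hε
    obtain ⟨N, hN⟩ := hK ((1 - Λ) * ε) (by positivity)
    refine ⟨N, fun m hm n hn p _ => ?_⟩
    wlog hmn : m ≤ n generalizing m n
    · rw [dist_comm]
      exact this n hn m hm (le_of_not_ge hmn)
    have hdiag (x : S) := hN m hm n hn (x, x) (Set.mem_univ _)
    simp only [dist_eq_norm', ← sum_Ico_eq_sub _ hmn] at hdiag
    rw [dist_eq_norm', hF, ← sum_Ico_eq_sub _ hmn]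
    calc _ ≤ _ := norm_sum_mul_conj_le (Ico m n) lam (fun i => lam i / (1 - lam i)) (1 - Λ)⁻¹
            (by positivity) hb hba (fun i => φ i p.1) (fun i => φ i p.2)
      _ < (1 - Λ)⁻¹ / 2 * ((1 - Λ) * ε + (1 - Λ) * ε) := by
          gcongr <;> exact hdiag _
      _ = ε := by field_simp; ring
  have hlim (p : S × S) : ∃ l, Tendsto (fun N => F N p) atTop (nhds l) :=
    cauchySeq_tendsto_of_complete (hcauchy.cauchySeq (Set.mem_univ p))
  choose L hL using hlim
  have hunif : TendstoUniformly F L atTop :=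
    tendstoUniformlyOn_univ.1 (hcauchy.tendstoUniformlyOn_of_tendsto fun p _ => hL p)
  refine ⟨L, hunif, hunif.continuous (Frequently.of_forall fun N => ?_)⟩
  fun_prop
end

section
/- Let k : ℝ → ℝ be an even function that is convex on [0, ∞) and nonincreasing on [0, ∞). Then for all a, b ∈ ℝ, |k(a) − k(b)| ≤ k(0) − k(|a − b|). -/
/-- A convex function on `[0, ∞)` is superadditive up to its value at `0`. -/
theorem ConvexOn.add_le_zero_add {k : ℝ → ℝ} (hconv : ConvexOn ℝ (Set.Ici (0 : ℝ)) k)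
    {x d : ℝ} (hx : 0 ≤ x) (hd : 0 ≤ d) : k x + k d ≤ k 0 + k (x + d) := by
  rcases (add_nonneg hx hd).eq_or_lt with hs | hs
  · obtain rfl : x = 0 := by linarith
    simp
  · have hne : x + d ≠ 0 := hs.ne'
    have hxs : 0 ≤ x / (x + d) := by positivity
    have hds : 0 ≤ d / (x + d) := by positivity
    have hsum : x / (x + d) + d / (x + d) = 1 := by field_simp
    have h₀ : (0 : ℝ) ∈ Set.Ici (0 : ℝ) := Set.mem_Ici.2 le_rfl
    have h₁ := hconv.2 h₀ (Set.mem_Ici.2 hs.le) hds hxs (by linarith)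
    have h₂ := hconv.2 h₀ (Set.mem_Ici.2 hs.le) hxs hds hsum
    simp only [smul_eq_mul, mul_zero, zero_add, div_mul_cancel₀ _ hne] at h₁ h₂
    linear_combination h₁ + h₂ + (k 0 + k (x + d)) * hsum

/-- For an even function `k` that is convex and nonincreasing on `[0, ∞)`,
`|k(a) - k(b)| ≤ k(0) - k(|a - b|)` for all real `a, b`. -/
theorem abs_sub_le_of_even_convex_antitone (k : ℝ → ℝ)
    (heven : ∀ t : ℝ, k (-t) = k t)
    (hconv : ConvexOn ℝ (Set.Ici (0 : ℝ)) k)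
    (hanti : AntitoneOn k (Set.Ici (0 : ℝ))) (a b : ℝ) :
    |k a - k b| ≤ k 0 - k |a - b| := by
  wlog hab : |a| ≤ |b| generalizing a b
  · rw [abs_sub_comm (k a), abs_sub_comm a]
    exact this b a (le_of_not_ge hab)
  have habs (t : ℝ) : k |t| = k t := by
    rcases abs_choice t with h | h <;> rw [h]
    exact heven t
  have hle : |b| - |a| ≤ |a - b| := by
    rw [abs_sub_comm]
    exact abs_sub_abs_le_abs_sub b a
  have hd : 0 ≤ |b| - |a| := sub_nonneg.2 hab
  have hsuper := hconv.add_le_zero_add (abs_nonneg a) hd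
  rw [add_sub_cancel, habs, habs] at hsuper
  have hmono := hanti (Set.mem_Ici.2 hd) (Set.mem_Ici.2 (abs_nonneg (a - b))) hle
  have hba := hanti (Set.mem_Ici.2 (abs_nonneg a)) (Set.mem_Ici.2 (abs_nonneg b)) hab
  rw [habs, habs] at hba
  rw [abs_of_nonneg (sub_nonneg.2 hba)]
  linarith
end

section
/- Let 0 < α < 1, c₂ > 0, let k : ℝ → ℝ be an even nonnegative function, convex and nonincreasing on [0, ∞), with k(0) ≤ 1 and k(0) − k(t) ≤ c₂ t^α for all 0 ≤ t ≤ 1, and let m : ℝ → ℝ satisfy 0 ≤ m(x) ≤ 1 for all x. Define K(x,y) = m(x) k(x−y) m(y). Then for all x, z ∈ ℝ and all 0 ≤ t ≤ 1, the 3 × 3 determinant det(K(y_i, y_j))_{1≤i,j≤3} with (y₁, y₂, y₃) = (x, x+t, z) satisfies |det(K(y_i,y_j))| ≤ 3√3 · c₂ · t^α. -/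
/-- The decrement of a convex function over an interval of length `t` in `[0,∞)` is largest at
the origin. -/
theorem ConvexOn.add_le_add_zero {k : ℝ → ℝ} (hconv : ConvexOn ℝ (Set.Ici (0 : ℝ)) k)
    {s t : ℝ} (hs : 0 ≤ s) (ht : 0 ≤ t) : k s + k t ≤ k 0 + k (s + t) := by
  rcases (add_nonneg hs ht).eq_or_lt with h | h
  · obtain rfl : s = 0 := by linarith
    simp
  · have hst : s + t ≠ 0 := h.ne'
    have h1 := hconv.2 (Set.mem_Ici.2 le_rfl) (Set.mem_Ici.2 h.le)
      (div_nonneg ht h.le) (div_nonneg hs h.le) (by field_simp; ring)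
    have h2 := hconv.2 (Set.mem_Ici.2 le_rfl) (Set.mem_Ici.2 h.le)
      (div_nonneg hs h.le) (div_nonneg ht h.le) (by field_simp)
    simp only [smul_eq_mul, mul_zero, zero_add, div_mul_cancel₀ _ hst] at h1 h2
    have h3 : t / (s + t) + s / (s + t) = 1 := by field_simp; ring
    linear_combination h1 + h2 + (k 0 + k (s + t)) * h3

/-- An even function which is convex and nonincreasing on `[0,∞)` has its increments bounded by
its increments at the origin. -/
theorem abs_sub_le_of_even_of_convexOn {k : ℝ → ℝ} (heven : ∀ t : ℝ, k (-t) = k t)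
    (hconv : ConvexOn ℝ (Set.Ici (0 : ℝ)) k) (hanti : AntitoneOn k (Set.Ici (0 : ℝ)))
    (u : ℝ) {t : ℝ} (ht : 0 ≤ t) : |k u - k (u + t)| ≤ k 0 - k t := by
  have mono : ∀ {a b : ℝ}, 0 ≤ a → a ≤ b → k b ≤ k a := fun ha hab =>
    hanti (Set.mem_Ici.2 ha) (Set.mem_Ici.2 (ha.trans hab)) hab
  have h0 := mono le_rfl ht
  rw [abs_le]
  rcases le_total 0 u with hu | hu
  · have h1 := hconv.add_le_add_zero hu ht
    have h2 := mono hu (show u ≤ u + t by linarith)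
    constructor <;> linarith
  rcases le_total (u + t) 0 with hv | hv
  · have hs : 0 ≤ -(u + t) := by linarith
    have h1 := hconv.add_le_add_zero hs ht
    have h2 := mono hs (show -(u + t) ≤ -u by linarith)
    rw [show -(u + t) + t = -u by ring] at h1
    rw [heven, heven] at h1 h2
    constructor <;> linarith
  · have hs : 0 ≤ -u := by linarith
    have h1 := mono le_rfl hs
    have h2 := mono hs (show -u ≤ t by linarith)
    have h3 := mono le_rfl hv
    have h4 := mono hv (show u + t ≤ t by linarith)
    rw [heven] at h1 h2
    constructor <;> linarith

/-- Bound for the determinant of the symmetric matrix `!![a, b, p; b, a, q; p, q, a]`. -/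
theorem abs_det_three_le {a b p q : ℝ} (hb : 0 ≤ b) (hba : b ≤ a) (ha : a ≤ 1)
    (hp : 0 ≤ p) (hpa : p ≤ a) (hq : 0 ≤ q) (hqa : q ≤ a) (hpq : |p - q| ≤ a - b) :
    |(a - b) * (a * (a + b) - 2 * (p * q)) - a * (p - q) ^ 2| ≤ 2 * (a - b) := by
  have ha0 : 0 ≤ a := hb.trans hba
  have hd : 0 ≤ a - b := by linarith
  have hsq : (p - q) ^ 2 ≤ (a - b) ^ 2 := sq_le_sq' (by linarith [(abs_le.1 hpq).1])
    (abs_le.1 hpq).2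
  have hpq0 : 0 ≤ p * q := mul_nonneg hp hq
  have hpqa : p * q ≤ a * a := mul_le_mul hpa hqa hq ha0
  have hasq : a * (p - q) ^ 2 ≤ a * (a - b) ^ 2 := mul_le_mul_of_nonneg_left hsq ha0
  have hasq0 : 0 ≤ a * (p - q) ^ 2 := by positivity
  rw [abs_le]
  constructor
  · have h1 : (a - b) * (-(a * (a - b))) ≤ (a - b) * (a * (a + b) - 2 * (p * q)) :=
      mul_le_mul_of_nonneg_left (by linarith) hd
    have h2 : a * (a - b) ≤ 1 := mul_le_one₀ ha hd (by linarith)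
    have h3 := mul_le_mul_of_nonneg_left h2 hd
    linarith
  · have h1 : a * (a + b) ≤ 1 * 2 := mul_le_mul ha (by linarith) (by linarith) zero_le_one
    have h2 : (a - b) * (a * (a + b) - 2 * (p * q)) ≤ (a - b) * 2 :=
      mul_le_mul_of_nonneg_left (by linarith) hd
    linarith

/-- Upper bound for the 3×3 determinant of the kernel `K(x,y) = m(x) k(x-y) m(y)`
at the points `(x, x+t, z)`: under the Hölder-type upper bound
`k(0) - k(t) ≤ c₂ t^α` (with `k` even, nonnegative, convex and nonincreasing on
`[0,∞)`, `k(0) ≤ 1`, `0 ≤ m ≤ 1`), one has `|det (K(y_i,y_j))| ≤ 3√3 c₂ t^α`. -/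
theorem det_three_upper_bound (α c₂ : ℝ) (hα0 : 0 < α) (hα1 : α < 1)
    (hc₂ : 0 < c₂) (k m : ℝ → ℝ)
    (hkeven : ∀ t : ℝ, k (-t) = k t) (hknn : ∀ t : ℝ, 0 ≤ k t)
    (hconv : ConvexOn ℝ (Set.Ici (0 : ℝ)) k)
    (hanti : AntitoneOn k (Set.Ici (0 : ℝ)))
    (hk0 : k 0 ≤ 1)
    (hkup : ∀ t : ℝ, 0 ≤ t → t ≤ 1 → k 0 - k t ≤ c₂ * t ^ α)
    (hm : ∀ x : ℝ, 0 ≤ m x ∧ m x ≤ 1)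
    (K : ℝ → ℝ → ℝ) (hK : ∀ x y : ℝ, K x y = m x * k (x - y) * m y)
    (x z t : ℝ) (ht0 : 0 ≤ t) (ht1 : t ≤ 1) :
    |(Matrix.of fun i j : Fin 3 =>
        K (![x, x + t, z] i) (![x, x + t, z] j)).det| ≤
      3 * Real.sqrt 3 * c₂ * t ^ α := by
  have hle : ∀ u : ℝ, k u ≤ k 0 := fun u => by
    rcases le_total 0 u with hu | hu
    · exact hanti (Set.mem_Ici.2 le_rfl) (Set.mem_Ici.2 hu) hu
    · rw [← hkeven u]
      exact hanti (Set.mem_Ici.2 le_rfl) (Set.mem_Ici.2 (by linarith)) (by linarith)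
  have hD := abs_det_three_le (hknn t) (hle t) hk0 (hknn (x - z)) (hle _)
    (hknn (x - z + t)) (hle _) (abs_sub_le_of_even_of_convexOn hkeven hconv hanti (x - z) ht0)
  have hdet : (Matrix.of fun i j : Fin 3 =>
        K (![x, x + t, z] i) (![x, x + t, z] j)).det =
      (m x * m (x + t) * m z) ^ 2 *
        ((k 0 - k t) * (k 0 * (k 0 + k t) - 2 * (k (x - z) * k (x - z + t)))
          - k 0 * (k (x - z) - k (x - z + t)) ^ 2) := by
    have e1 : k (x - (x + t)) = k t := by rw [← hkeven t]; congr 1; ring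
    have e2 : k (x + t - x) = k t := by congr 1; ring
    have e3 : k (x + t - z) = k (x - z + t) := by congr 1; ring
    have e4 : k (z - x) = k (x - z) := by rw [← hkeven (x - z)]; congr 1; ring
    have e5 : k (z - (x + t)) = k (x - z + t) := by
      rw [← hkeven (x - z + t)]; congr 1; ring
    simp only [Matrix.det_fin_three, Matrix.of_apply, Matrix.cons_val, hK, sub_self,
      e1, e2, e3, e4, e5]
    ring
  have hM0 : 0 ≤ m x * m (x + t) * m z :=
    mul_nonneg (mul_nonneg (hm _).1 (hm _).1) (hm _).1
  have hM1 : m x * m (x + t) * m z ≤ 1 :=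
    mul_le_one₀ (mul_le_one₀ (hm _).2 (hm _).1 (hm _).2) (hm _).1 (hm _).2
  have hsqrt : 1 ≤ Real.sqrt 3 := Real.one_le_sqrt.2 (by norm_num)
  have hct : 0 ≤ c₂ * t ^ α := mul_nonneg hc₂.le (Real.rpow_nonneg ht0 α)
  rw [hdet, abs_mul, abs_of_nonneg (sq_nonneg (m x * m (x + t) * m z))]
  calc _ ≤ 1 * (2 * (k 0 - k t)) :=
        mul_le_mul (pow_le_one₀ hM0 hM1) hD (abs_nonneg _) zero_le_one
    _ ≤ 2 * (c₂ * t ^ α) := by linarith [hkup t ht0 ht1]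
    _ ≤ (3 * Real.sqrt 3) * (c₂ * t ^ α) :=
        mul_le_mul_of_nonneg_right (by linarith) hct
    _ = 3 * Real.sqrt 3 * c₂ * t ^ α := by ring
end

section
/- Let 0 < α < 1 and c₁, c₂ > 0. Let k : ℝ → ℝ be an even nonnegative function, convex and nonincreasing on [0, ∞), with k(0) ≤ 1 and c₁ t^α ≤ k(0) − k(t) ≤ c₂ t^α for all 0 ≤ t ≤ 1. Let m : ℝ → ℝ be continuous with 0 ≤ m(x) ≤ 1 for all x and m(x₀) > 0 for some x₀. Define K(x,y) = m(x) k(x−y) m(y). Then there exist a nonempty bounded open interval I ⊆ ℝ and a constant c > 0 such that for all x and all 0 < t ≤ 1 with x ∈ I and x + t ∈ I: det(K(y_i,y_j))_{1≤i,j≤2} − ∫_I |det(K(y_i,y_j,z))_{1≤i,j≤3}| dz ≥ c t^α, where the 2×2 determinant is taken at the points (x, x+t) and the 3×3 determinant at the points (x, x+t, z). -/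
open MeasureTheory

/-- A convex function on `[0, ∞)` is superadditive up to its value at `0`. -/
lemma ConvexOn.add_le_zero_add_s11 {k : ℝ → ℝ} (hconv : ConvexOn ℝ (Set.Ici (0 : ℝ)) k)
    {s h : ℝ} (hs : 0 ≤ s) (hh : 0 ≤ h) : k s + k h ≤ k 0 + k (s + h) := by
  rcases hs.eq_or_lt with rfl | hs'
  · simp
  have hpos : 0 < s + h := by linarith
  have h0 : (0 : ℝ) ∈ Set.Ici (0 : ℝ) := Set.mem_Ici.2 le_rfl
  have hsh : s + h ∈ Set.Ici (0 : ℝ) := Set.mem_Ici.2 hpos.le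
  have hsum : h / (s + h) + s / (s + h) = 1 := by field_simp; ring
  have hs1 : 0 ≤ s / (s + h) := by positivity
  have hh1 : 0 ≤ h / (s + h) := by positivity
  have h1 := hconv.2 h0 hsh hh1 hs1 hsum
  have h2 := hconv.2 h0 hsh hs1 hh1 (by linarith)
  simp only [smul_eq_mul, mul_zero, zero_add, div_mul_cancel₀ _ hpos.ne'] at h1 h2
  linear_combination h1 + h2 + (k 0 + k (s + h)) * hsum

/-- An even function that is convex and nonincreasing on `[0, ∞)` has increments
bounded by its increment at `0`. -/
lemma abs_sub_le_zero_sub_of_even_convexOn {k : ℝ → ℝ} (hkeven : ∀ t, k (-t) = k t)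
    (hconv : ConvexOn ℝ (Set.Ici (0 : ℝ)) k) (hanti : AntitoneOn k (Set.Ici (0 : ℝ)))
    {r s t : ℝ} (hrs : |r - s| ≤ t) : |k r - k s| ≤ k 0 - k t := by
  have habs (x : ℝ) : k |x| = k x := by
    rcases abs_choice x with h | h <;> rw [h]
    exact hkeven x
  have key {p q : ℝ} (hp : 0 ≤ p) (hpq : p ≤ q) (hqt : q - p ≤ t) :
      |k p - k q| ≤ k 0 - k t := by
    have hq : 0 ≤ q - p := sub_nonneg.2 hpq
    have h1 := hconv.add_le_zero_add_s11 hp hq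
    rw [add_sub_cancel] at h1
    have h2 := hanti (Set.mem_Ici.2 hp) (Set.mem_Ici.2 (hp.trans hpq)) hpq
    have h3 := hanti (Set.mem_Ici.2 hq) (Set.mem_Ici.2 (hq.trans hqt)) hqt
    rw [abs_of_nonneg (sub_nonneg.2 h2)]
    linarith
  have hd := abs_le.1 ((abs_abs_sub_abs_le_abs_sub r s).trans hrs)
  rw [← habs r, ← habs s]
  rcases le_total |r| |s| with h | h
  · exact key (abs_nonneg r) h (by linarith)
  · rw [abs_sub_comm]
    exact key (abs_nonneg s) h (by linarith)

/-- Bound for the determinant of the correlation matrix with diagonal `A` and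
off-diagonal entries `p, u, v`. -/
lemma abs_correlation_det_le {A p u v : ℝ} (hA : A ≤ 1) (hp : 0 ≤ p) (hpA : p ≤ A)
    (hu : 0 ≤ u) (huA : u ≤ A) (hv : 0 ≤ v) (hvA : v ≤ A) (huv : |u - v| ≤ A - p) :
    |A ^ 3 + 2 * p * u * v - A * p ^ 2 - A * u ^ 2 - A * v ^ 2| ≤ 3 * (A - p) := by
  have hA0 : 0 ≤ A := hp.trans hpA
  have hd : 0 ≤ A - p := sub_nonneg.2 hpA
  have hsq : (u - v) ^ 2 ≤ A - p := by
    calc (u - v) ^ 2 = |u - v| ^ 2 := (sq_abs _).symm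
      _ ≤ (A - p) ^ 2 := by gcongr
      _ ≤ A - p := by nlinarith
  have hsqA : A * (u - v) ^ 2 ≤ A - p :=
    (mul_le_of_le_one_left (sq_nonneg _) hA).trans hsq
  have hsqA0 : 0 ≤ A * (u - v) ^ 2 := by positivity
  have huv0 : 0 ≤ u * v := by positivity
  have huv1 : u * v ≤ 1 := mul_le_one₀ (huA.trans hA) hv (hvA.trans hA)
  have hAp0 : 0 ≤ A * (A + p) := by positivity
  have hAp1 : A * (A + p) ≤ 2 := by nlinarith
  have heq : A ^ 3 + 2 * p * u * v - A * p ^ 2 - A * u ^ 2 - A * v ^ 2 =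
      (A - p) * (A * (A + p) - 2 * (u * v)) - A * (u - v) ^ 2 := by ring
  have hlo := mul_le_mul_of_nonneg_left (show -2 ≤ A * (A + p) - 2 * (u * v) by linarith) hd
  have hhi := mul_le_mul_of_nonneg_left (show A * (A + p) - 2 * (u * v) ≤ 2 by linarith) hd
  rw [heq, abs_le]
  constructor <;> linarith

/-- Lemma 5.3 of the paper: for a kernel `K(x,y) = m(x) k(x-y) m(y)` with `k`
even, nonnegative, convex and nonincreasing on `[0,∞)`, `k(0) ≤ 1`, satisfying
`c₁ t^α ≤ k(0) - k(t) ≤ c₂ t^α` on `[0,1]`, and `m` continuous with `0 ≤ m ≤ 1`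
and `m(x₀) > 0` somewhere, there exist a nonempty bounded open interval `I` and
`c > 0` such that for `x, x+t ∈ I`, `0 < t ≤ 1`,
`ρ₂(x, x+t) - ∫_I ρ₃(x, x+t, z) dz ≥ c t^α`. -/
theorem density_two_lower_bound (α c₁ c₂ : ℝ) (hα0 : 0 < α) (hα1 : α < 1)
    (hc₁ : 0 < c₁) (hc₂ : 0 < c₂) (k m : ℝ → ℝ)
    (hkeven : ∀ t : ℝ, k (-t) = k t) (hknn : ∀ t : ℝ, 0 ≤ k t)
    (hconv : ConvexOn ℝ (Set.Ici (0 : ℝ)) k)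
    (hanti : AntitoneOn k (Set.Ici (0 : ℝ)))
    (hk0 : k 0 ≤ 1)
    (hklow : ∀ t : ℝ, 0 ≤ t → t ≤ 1 → c₁ * t ^ α ≤ k 0 - k t)
    (hkup : ∀ t : ℝ, 0 ≤ t → t ≤ 1 → k 0 - k t ≤ c₂ * t ^ α)
    (hmcont : Continuous m) (hm : ∀ x : ℝ, 0 ≤ m x ∧ m x ≤ 1)
    (x₀ : ℝ) (hx₀ : 0 < m x₀)
    (K : ℝ → ℝ → ℝ) (hK : ∀ x y : ℝ, K x y = m x * k (x - y) * m y) :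
    ∃ (a b : ℝ), a < b ∧ ∃ c : ℝ, 0 < c ∧
      ∀ x t : ℝ, x ∈ Set.Ioo a b → x + t ∈ Set.Ioo a b → 0 < t → t ≤ 1 →
        c * t ^ α ≤
          (Matrix.of fun i j : Fin 2 =>
              K (![x, x + t] i) (![x, x + t] j)).det -
            ∫ z in Set.Ioo a b,
              |(Matrix.of fun i j : Fin 3 =>
                  K (![x, x + t, z] i) (![x, x + t, z] j)).det| := by
  have hA : 0 < k 0 := by
    have h := hklow 1 zero_le_one le_rfl
    rw [Real.one_rpow] at h
    linarith [hknn 1]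
  have hkle (s : ℝ) : k s ≤ k 0 := by
    rcases le_total 0 s with h | h
    · exact hanti (Set.mem_Ici.2 le_rfl) (Set.mem_Ici.2 h) h
    · rw [← hkeven]
      exact hanti (Set.mem_Ici.2 le_rfl) (Set.mem_Ici.2 (neg_nonneg.2 h)) (neg_nonneg.2 h)
  obtain ⟨δ, hδ, hmδ⟩ := Metric.eventually_nhds_iff.1
    (hmcont.continuousAt.eventually (lt_mem_nhds (half_lt_self hx₀)))
  set r := min δ (k 0 / 12)
  have hr0 : 0 < r := lt_min hδ (by positivity)
  have hrA : r ≤ k 0 / 12 := min_le_right _ _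
  have hmI {y : ℝ} (hy : y ∈ Set.Ioo (x₀ - r) (x₀ + r)) : m x₀ / 2 ≤ m y := by
    refine (hmδ ?_).le
    rw [Real.dist_eq]
    refine lt_of_lt_of_le (abs_lt.2 ⟨?_, ?_⟩) (min_le_left δ (k 0 / 12)) <;> linarith [hy.1, hy.2]
  refine ⟨x₀ - r, x₀ + r, by linarith, (m x₀ / 2) ^ 4 * (c₁ * (k 0 / 2)), by positivity, ?_⟩
  intro x t hx hxt ht ht1
  set M := m x ^ 2 * m (x + t) ^ 2 with hM
  have hM0 : 0 ≤ M := by positivity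
  have hMlow : (m x₀ / 2) ^ 4 ≤ M := by
    have h1 := hmI hx
    have h2 := hmI hxt
    calc (m x₀ / 2) ^ 4 = (m x₀ / 2) ^ 2 * (m x₀ / 2) ^ 2 := by ring
      _ ≤ M := by rw [hM]; gcongr
  have hd0 : 0 ≤ k 0 - k t := sub_nonneg.2 (hkle t)
  have hdet2 : (Matrix.of fun i j : Fin 2 =>
      K (![x, x + t] i) (![x, x + t] j)).det = M * ((k 0 - k t) * (k 0 + k t)) := by
    have e : x - (x + t) = -t := by ring
    simp [Matrix.det_fin_two, hK, e, hkeven, hM]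
    ring
  have hdet3 (z : ℝ) : ‖|(Matrix.of fun i j : Fin 3 =>
      K (![x, x + t, z] i) (![x, x + t, z] j)).det|‖ ≤ M * (3 * (k 0 - k t)) := by
    have e : x - (x + t) = -t := by ring
    have e1 : k (z - x) = k (x - z) := by rw [← hkeven, neg_sub]
    have e2 : k (z - (x + t)) = k (x + t - z) := by rw [← hkeven, neg_sub]
    have hdet : (Matrix.of fun i j : Fin 3 =>
        K (![x, x + t, z] i) (![x, x + t, z] j)).det =
        M * (m z ^ 2 * (k 0 ^ 3 + 2 * k t * k (x - z) * k (x + t - z) - k 0 * k t ^ 2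
          - k 0 * k (x - z) ^ 2 - k 0 * k (x + t - z) ^ 2)) := by
      simp [Matrix.det_fin_three, hK, e, e1, e2, hkeven, hM]
      ring
    have hinc : |k (x - z) - k (x + t - z)| ≤ k 0 - k t := by
      refine abs_sub_le_zero_sub_of_even_convexOn hkeven hconv hanti ?_
      rw [show x - z - (x + t - z) = -t by ring, abs_neg, abs_of_pos ht]
    have hcorr := abs_correlation_det_le hk0 (hknn t) (hkle t) (hknn (x - z)) (hkle _)
      (hknn (x + t - z)) (hkle _) hinc
    rw [Real.norm_eq_abs, abs_abs, hdet, abs_mul, abs_of_nonneg hM0, abs_mul,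
      abs_of_nonneg (sq_nonneg (m z))]
    refine mul_le_mul_of_nonneg_left (le_trans ?_ hcorr) hM0
    exact mul_le_of_le_one_left (abs_nonneg _) (pow_le_one₀ (hm z).1 (hm z).2)
  have hint := (le_abs_self _).trans (norm_setIntegral_le_of_norm_le_const
    (μ := volume) (s := Set.Ioo (x₀ - r) (x₀ + r)) (by simp) fun z _ => hdet3 z)
  have hvol : volume.real (Set.Ioo (x₀ - r) (x₀ + r)) = 2 * r := by
    rw [Real.volume_real_Ioo_of_le (by linarith)]
    ring
  rw [hvol] at hint
  have hMd : 0 ≤ M * (k 0 - k t) := mul_nonneg hM0 hd0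
  calc (m x₀ / 2) ^ 4 * (c₁ * (k 0 / 2)) * t ^ α
      = (m x₀ / 2) ^ 4 * (c₁ * t ^ α) * (k 0 / 2) := by ring
    _ ≤ M * (k 0 - k t) * (k 0 / 2) := by
      have := hklow t ht.le ht1
      gcongr
    _ ≤ M * (k 0 - k t) * (k 0 + k t - 6 * r) := by
      gcongr
      linarith [hknn t]
    _ = M * ((k 0 - k t) * (k 0 + k t)) - M * (3 * (k 0 - k t)) * (2 * r) := by ring
    _ ≤ _ := by
      rw [hdet2]
      exact sub_le_sub_left hint _
end

section
/- For every δ > 0 there exists an infinitely differentiable function f : ℝ → ℝ with compact support contained in the open interval (−2, 2), with 0 ≤ f(t) ≤ 1 for all t, such that f equals 1 on an open neighborhood of 0 and ∫_ℝ f'(t)² · |t| dt < δ. -/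
open MeasureTheory

/-- The weight `|t| / (t² + ε)` has logarithmically growing mass on `[-1, 1]` as `ε → 0`. -/
lemma integral_abs_div_sq_add {ε : ℝ} (hε : 0 < ε) :
    ∫ t in (-1 : ℝ)..1, |t| / (t ^ 2 + ε) = Real.log (1 + ε) - Real.log ε := by
  have hpos : ∀ t : ℝ, 0 < t ^ 2 + ε := fun t => by positivity
  have hcont : Continuous fun t : ℝ => |t| / (t ^ 2 + ε) :=
    continuous_abs.div (by fun_prop) fun t => (hpos t).ne'
  have hright : ∫ t in (0 : ℝ)..1, |t| / (t ^ 2 + ε)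
      = Real.log (1 + ε) / 2 - Real.log ε / 2 := by
    rw [intervalIntegral.integral_eq_sub_of_hasDerivAt
      (f := fun t => Real.log (t ^ 2 + ε) / 2) _ (hcont.intervalIntegrable _ _)]
    · simp
    · intro t ht
      rw [Set.uIcc_of_le zero_le_one] at ht
      rw [abs_of_nonneg ht.1]
      refine ((((hasDerivAt_pow 2 t).add_const ε).log (hpos t).ne').div_const 2).congr_deriv ?_
      norm_num
      ring
  have hleft : ∫ t in (-1 : ℝ)..0, |t| / (t ^ 2 + ε)
      = ∫ t in (0 : ℝ)..1, |t| / (t ^ 2 + ε) := by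
    have h := intervalIntegral.integral_comp_neg (a := (-1 : ℝ)) (b := 0)
      fun t : ℝ => |t| / (t ^ 2 + ε)
    simpa using h
  rw [← intervalIntegral.integral_add_adjacent_intervals
    (hcont.intervalIntegrable (-1) 0) (hcont.intervalIntegrable 0 1), hleft, hright]
  ring

/-- The smooth logarithmic cutoff at scale `ε = exp (-2L)`. -/
noncomputable def logCutoff (L t : ℝ) : ℝ :=
  Real.smoothTransition (-Real.log (t ^ 2 + Real.exp (-2 * L)) / L)

lemma sq_add_exp_pos (L t : ℝ) : 0 < t ^ 2 + Real.exp (-2 * L) := by positivity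

lemma contDiff_logCutoff (L : ℝ) : ContDiff ℝ (⊤ : ℕ∞) (logCutoff L) := by
  have h : ContDiff ℝ (⊤ : ℕ∞) fun t : ℝ => t ^ 2 + Real.exp (-2 * L) := by fun_prop
  exact Real.smoothTransition.contDiff.comp
    (((h.log fun t => (sq_add_exp_pos L t).ne').neg).div_const L)

lemma tsupport_logCutoff_subset {L : ℝ} (hL : 0 < L) :
    tsupport (logCutoff L) ⊆ Set.Icc (-1) 1 := by
  refine closure_minimal (fun t ht => ?_) isClosed_Icc
  rw [Set.mem_Icc, ← abs_le]
  by_contra! h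
  refine ht (Real.smoothTransition.zero_of_nonpos
    (div_nonpos_of_nonpos_of_nonneg (neg_nonpos.2 (Real.log_nonneg ?_)) hL.le))
  have h2 : 1 ≤ t ^ 2 := by rw [← sq_abs]; nlinarith
  linarith [Real.exp_pos (-2 * L)]

lemma eventually_logCutoff_eq_one {L : ℝ} (hL : 0 < L) :
    ∀ᶠ t in nhds 0, logCutoff L t = 1 := by
  have hc : ContinuousAt (fun t : ℝ => -Real.log (t ^ 2 + Real.exp (-2 * L)) / L) 0 := by
    have h : ContinuousAt (fun t : ℝ => t ^ 2 + Real.exp (-2 * L)) 0 := by fun_prop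
    exact (h.log (sq_add_exp_pos L 0).ne').neg.div_const L
  have h0 : (1 : ℝ) < -Real.log ((0 : ℝ) ^ 2 + Real.exp (-2 * L)) / L := by
    rw [lt_div_iff₀ hL]
    simp
    linarith
  filter_upwards [hc.eventually (lt_mem_nhds h0)] with t ht
  exact Real.smoothTransition.one_of_one_le ht.le

lemma deriv_logCutoff (L t : ℝ) :
    deriv (logCutoff L) t =
      deriv Real.smoothTransition (-Real.log (t ^ 2 + Real.exp (-2 * L)) / L) *
        (-(2 * t / (t ^ 2 + Real.exp (-2 * L))) / L) := by
  have hS : HasDerivAt Real.smoothTransition _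
      (-Real.log (t ^ 2 + Real.exp (-2 * L)) / L) :=
    ((Real.smoothTransition.contDiff (n := 1)).differentiable (by simp) _).hasDerivAt
  have h := (((hasDerivAt_pow 2 t).add_const (Real.exp (-2 * L))).log
    (sq_add_exp_pos L t).ne').neg.div_const L
  have hf : HasDerivAt (logCutoff L) _ t := hS.comp t h
  simpa using hf.deriv

lemma log_one_add_exp_le_one {L : ℝ} (hL : 0 ≤ L) : Real.log (1 + Real.exp (-2 * L)) ≤ 1 := by
  have h1 : Real.exp (-2 * L) ≤ 1 := Real.exp_le_one_iff.2 (by linarith)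
  have := Real.log_le_sub_one_of_pos (show 0 < 1 + Real.exp (-2 * L) by positivity)
  linarith

/-- On `[-1, 1]` the argument of the smooth transition in `logCutoff` stays in `[-1, 2]`. -/
lemma neg_log_div_mem_Icc {L t : ℝ} (hL : 1 ≤ L) (ht : t ∈ Set.Icc (-1 : ℝ) 1) :
    -Real.log (t ^ 2 + Real.exp (-2 * L)) / L ∈ Set.Icc (-1 : ℝ) 2 := by
  have hL0 : 0 < L := by linarith
  have ht2 : t ^ 2 ≤ 1 := by nlinarith [ht.1, ht.2]
  have hup : Real.log (t ^ 2 + Real.exp (-2 * L)) ≤ 1 :=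
    (Real.log_le_log (sq_add_exp_pos L t) (by linarith)).trans (log_one_add_exp_le_one hL0.le)
  have hlow : -2 * L ≤ Real.log (t ^ 2 + Real.exp (-2 * L)) := by
    rw [Real.le_log_iff_exp_le (sq_add_exp_pos L t)]
    nlinarith [sq_nonneg t]
  constructor
  · rw [le_div_iff₀ hL0]; linarith
  · rw [div_le_iff₀ hL0]; linarith

lemma integral_sq_deriv_logCutoff_le {C L : ℝ} (hL : 1 ≤ L)
    (hC : ∀ u ∈ Set.Icc (-1 : ℝ) 2, |deriv Real.smoothTransition u| ≤ C) :
    ∫ t : ℝ, (deriv (logCutoff L) t) ^ 2 * |t| ≤ 12 * C ^ 2 / L := by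
  have hL0 : 0 < L := by linarith
  set ε := Real.exp (-2 * L) with hε
  have hpos : ∀ t : ℝ, 0 < t ^ 2 + ε := sq_add_exp_pos L
  have hcont : Continuous fun t : ℝ => 4 * C ^ 2 / L ^ 2 * (|t| / (t ^ 2 + ε)) :=
    continuous_const.mul (continuous_abs.div (by fun_prop) fun t => (hpos t).ne')
  calc ∫ t : ℝ, (deriv (logCutoff L) t) ^ 2 * |t|
      ≤ ∫ t : ℝ, (Set.Icc (-1 : ℝ) 1).indicator
          (fun t => 4 * C ^ 2 / L ^ 2 * (|t| / (t ^ 2 + ε))) t := by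
        refine integral_mono_of_nonneg (.of_forall fun t => by positivity)
          (hcont.continuousOn.integrableOn_Icc.integrable_indicator measurableSet_Icc)
          (.of_forall fun t => ?_)
        by_cases ht : t ∈ Set.Icc (-1 : ℝ) 1
        · have hu := hC _ (neg_log_div_mem_Icc hL ht)
          simp only [Set.indicator_of_mem ht, deriv_logCutoff, ← hε] at hu ⊢
          have hsq := sq_le_sq' (neg_le_of_abs_le hu) (le_of_abs_le hu)
          have hle : t ^ 2 / (t ^ 2 + ε) ≤ 1 := by
            rw [div_le_one (hpos t)]
            linarith [Real.exp_pos (-2 * L)]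
          calc _ = deriv Real.smoothTransition (-Real.log (t ^ 2 + ε) / L) ^ 2 *
                (t ^ 2 / (t ^ 2 + ε)) * (4 / L ^ 2 * (|t| / (t ^ 2 + ε))) := by
                have := (hpos t).ne'
                field_simp
                ring
            _ ≤ C ^ 2 * 1 * (4 / L ^ 2 * (|t| / (t ^ 2 + ε))) := by
                have := hpos t
                gcongr
            _ = _ := by ring
        · have h0 : deriv (logCutoff L) t = 0 := by
            by_contra h
            exact ht (tsupport_logCutoff_subset hL0 (support_deriv_subset h))
          simp [Set.indicator_of_notMem ht, h0]
    _ = 4 * C ^ 2 / L ^ 2 * (Real.log (1 + ε) - Real.log ε) := by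
        rw [integral_indicator measurableSet_Icc, integral_Icc_eq_integral_Ioc,
          ← intervalIntegral.integral_of_le (by norm_num),
          intervalIntegral.integral_const_mul, integral_abs_div_sq_add (Real.exp_pos _)]
    _ ≤ 4 * C ^ 2 / L ^ 2 * (3 * L) := by
        have h1 := log_one_add_exp_le_one hL0.le
        have h2 : Real.log ε = -2 * L := Real.log_exp _
        gcongr
        linarith
    _ = 12 * C ^ 2 / L := by field_simp; ring

/-- Zero-capacity estimate in dimension one with weight `|t|`: for every `δ > 0`
there is a smooth `f` with compact support in `(-2, 2)`, `0 ≤ f ≤ 1`, equal to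
`1` near `0`, whose weighted energy `∫ f'(t)² |t| dt` is less than `δ`. -/
theorem polar_point_linear_weight (δ : ℝ) (hδ : 0 < δ) :
    ∃ f : ℝ → ℝ, ContDiff ℝ (⊤ : ℕ∞) f ∧ HasCompactSupport f ∧
      tsupport f ⊆ Set.Ioo (-2 : ℝ) 2 ∧
      (∀ t : ℝ, 0 ≤ f t ∧ f t ≤ 1) ∧
      (∃ U : Set ℝ, IsOpen U ∧ (0 : ℝ) ∈ U ∧ ∀ t ∈ U, f t = 1) ∧
      ∫ t : ℝ, (deriv f t) ^ 2 * |t| < δ := by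
  obtain ⟨C, hC⟩ := (isCompact_Icc (a := (-1 : ℝ)) (b := 2)).exists_bound_of_continuousOn
    ((Real.smoothTransition.contDiff (n := 1)).continuous_deriv (by simp)).continuousOn
  have hL : 1 ≤ 12 * C ^ 2 / δ + 1 := by
    have : 0 ≤ 12 * C ^ 2 / δ := by positivity
    linarith
  set L := 12 * C ^ 2 / δ + 1 with hLdef
  have hL0 : 0 < L := by linarith
  have hsupp := tsupport_logCutoff_subset hL0
  obtain ⟨U, hU, hUo, h0⟩ := eventually_nhds_iff.1 (eventually_logCutoff_eq_one hL0)
  refine ⟨logCutoff L, contDiff_logCutoff L,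
    isCompact_Icc.of_isClosed_subset (isClosed_tsupport _) hsupp,
    hsupp.trans (Set.Icc_subset_Ioo (by norm_num) (by norm_num)),
    fun t => ⟨Real.smoothTransition.nonneg _, Real.smoothTransition.le_one _⟩,
    ⟨U, hUo, h0, hU⟩, (integral_sq_deriv_logCutoff_le hL hC).trans_lt ?_⟩
  rw [div_lt_iff₀ hL0, hLdef]
  field_simp
  linarith
end

section
/- Let 0 < α < 1. Then there exists a constant c > 0 such that for every continuously differentiable function f : ℝ → ℝ with compact support satisfying f(0) ≥ 1, one has ∫_ℝ f'(t)² |t|^α dt + ∫_ℝ f(t)² |t|^α dt ≥ c. -/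
open MeasureTheory

/-- Weighted Young inequality. -/
theorem mul_le_sq_mul_add_inv_weight {x w v s b : ℝ} (hs : 0 < s) (hv : 0 ≤ v) (hwv : w * v = 1)
    (hb : b ^ 2 ≤ 1) : x * b ≤ s⁻¹ * (x ^ 2 * w) + s / 4 * v := by
  have h : 0 ≤ (2 * x * w - s * b) ^ 2 * v := by positivity
  have h' : (2 * x * w - s * b) ^ 2 * v
      = 4 * x ^ 2 * w * (w * v) - 4 * s * x * b * (w * v) + s ^ 2 * v * b ^ 2 := by ring
  rw [h', hwv] at h
  have h2 : s ^ 2 * v * b ^ 2 ≤ s ^ 2 * v := mul_le_of_le_one_right (by positivity) hb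
  have h3 : s⁻¹ * (x ^ 2 * w) + s / 4 * v - x * b
      = (4 * s)⁻¹ * (4 * x ^ 2 * w - 4 * s * x * b + s ^ 2 * v) := by
    field_simp
    ring
  have h4 : 0 ≤ (4 * s)⁻¹ * (4 * x ^ 2 * w - 4 * s * x * b + s ^ 2 * v) :=
    mul_nonneg (by positivity) (by linarith)
  linarith

theorem eq_intervalIntegral_sub_deriv_mul {f : ℝ → ℝ} (hf : ContDiff ℝ 1 f) :
    f 0 = ∫ t in (0 : ℝ)..1, (f t - deriv f t * (1 - t)) := by
  have hf' : Continuous (deriv f) := hf.continuous_deriv le_rfl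
  have hd (t : ℝ) : HasDerivAt (fun t => -(f t * (1 - t))) (f t - deriv f t * (1 - t)) t := by
    have h := ((hf.differentiable one_ne_zero t).hasDerivAt.mul
      ((hasDerivAt_id t).const_sub 1)).neg
    exact h.congr_deriv (by simp only [id]; ring)
  have hc : Continuous fun t => f t - deriv f t * (1 - t) := by
    have := hf.continuous
    fun_prop
  rw [intervalIntegral.integral_eq_sub_of_hasDerivAt (fun t _ => hd t)
    (hc.intervalIntegrable 0 1)]
  simp

theorem integrable_sq_mul_abs_rpow {g : ℝ → ℝ} (hg : Continuous g) (hs : HasCompactSupport g)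
    {α : ℝ} (hα : 0 ≤ α) : Integrable fun t => g t ^ 2 * |t| ^ α := by
  refine Continuous.integrable_of_hasCompactSupport ?_ ?_
  · exact (hg.pow 2).mul (continuous_abs.rpow_const fun _ => Or.inr hα)
  · refine hs.mono fun t ht h0 => ht ?_
    simp [h0]

theorem intervalIntegral_le_integral_of_nonneg {g : ℝ → ℝ} (hg : Integrable g) (h0 : ∀ t, 0 ≤ g t)
    {a b : ℝ} (hab : a ≤ b) : ∫ t in a..b, g t ≤ ∫ t, g t := by
  rw [intervalIntegral.integral_of_le hab]
  exact setIntegral_le_integral hg (Filter.Eventually.of_forall h0)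

/-- Positive-capacity estimate in dimension one with weight `|t|^α`, `0 < α < 1`:
there is a constant `c > 0` such that every `C¹` function `f` with compact
support and `f(0) ≥ 1` has weighted energy
`∫ f'(t)² |t|^α dt + ∫ f(t)² |t|^α dt ≥ c`. -/
theorem positive_capacity_holder_weight (α : ℝ) (hα0 : 0 < α) (hα1 : α < 1) :
    ∃ c : ℝ, 0 < c ∧
      ∀ f : ℝ → ℝ, ContDiff ℝ 1 f → HasCompactSupport f → 1 ≤ f 0 →
        c ≤ (∫ t : ℝ, (deriv f t) ^ 2 * |t| ^ α) +
            ∫ t : ℝ, (f t) ^ 2 * |t| ^ α := by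
  have hs : 0 < 1 - α := by linarith
  refine ⟨(1 - α) / 2, by positivity, fun f hf hsupp h1 => ?_⟩
  have hf' : Continuous (deriv f) := hf.continuous_deriv le_rfl
  have hfc := hf.continuous
  have hi' := integrable_sq_mul_abs_rpow hf' hsupp.deriv hα0.le
  have hi := integrable_sq_mul_abs_rpow hfc hsupp hα0.le
  have hle' := intervalIntegral_le_integral_of_nonneg hi' (fun t => by positivity) zero_le_one
  have hle := intervalIntegral_le_integral_of_nonneg hi (fun t => by positivity) zero_le_one
  have hw : IntervalIntegrable (fun t : ℝ => t ^ (-α)) volume 0 1 :=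
    intervalIntegral.intervalIntegrable_rpow' (by linarith)
  have hwi : ∫ t in (0 : ℝ)..1, t ^ (-α) = (1 - α)⁻¹ := by
    rw [integral_rpow (Or.inl (by linarith)), Real.one_rpow, Real.zero_rpow (by linarith)]
    rw [sub_zero, one_div, neg_add_eq_sub]
  have hsum := ((hi'.intervalIntegrable (a := 0) (b := 1)).add
    (hi.intervalIntegrable (a := 0) (b := 1))).const_mul (1 - α)⁻¹
  have hmono : ∫ t in (0 : ℝ)..1, (f t - deriv f t * (1 - t)) ≤
      ∫ t in (0 : ℝ)..1, ((1 - α)⁻¹ * (deriv f t ^ 2 * |t| ^ α + f t ^ 2 * |t| ^ α)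
        + (1 - α) / 2 * t ^ (-α)) := by
    refine intervalIntegral.integral_mono_on_of_le_Ioo zero_le_one
      (Continuous.intervalIntegrable (by fun_prop) 0 1) (hsum.add (hw.const_mul _)) ?_
    rintro t ⟨ht0, ht1⟩
    have hwv : |t| ^ α * t ^ (-α) = 1 := by
      rw [abs_of_pos ht0, ← Real.rpow_add ht0, add_neg_cancel, Real.rpow_zero]
    have hv : 0 ≤ t ^ (-α) := by positivity
    have ha := mul_le_sq_mul_add_inv_weight (x := f t) (b := 1) hs hv hwv (by norm_num)
    have hb := mul_le_sq_mul_add_inv_weight (x := deriv f t) (b := t - 1) hs hv hwv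
      (by nlinarith)
    linarith
  rw [← eq_intervalIntegral_sub_deriv_mul hf,
    intervalIntegral.integral_add hsum (hw.const_mul _), intervalIntegral.integral_const_mul,
    intervalIntegral.integral_const_mul, intervalIntegral.integral_add hi'.intervalIntegrable
      hi.intervalIntegrable, hwi] at hmono
  have hhalf : (1 - α) / 2 * (1 - α)⁻¹ = 1 / 2 := by field_simp
  rw [hhalf] at hmono
  have hlow : 1 / 2 ≤ (1 - α)⁻¹ * ((∫ t in (0 : ℝ)..1, deriv f t ^ 2 * |t| ^ α)
      + ∫ t in (0 : ℝ)..1, f t ^ 2 * |t| ^ α) := by linarith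
  rw [inv_mul_eq_div, le_div_iff₀ hs] at hlow
  linarith
end
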